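/- In the golf model on Z/nZ with parameters n, n_b, n_t, p, assume n_t = n_b + 1 (so 2n_b + 1 ≤ n). Then for every vertex x ∈ Z/nZ: P(TL = {x}) = 1/n, and P(TL = {x} | x ∈ T⁰) = 1/(n_b + 1). -/

import Mathlib

open Finset MeasureTheory Filter Asymptotics
open scoped Classical

namespace Golf

/-- Canonical position of a vertex of the cycle `Z/nZ` in `{1, …, n}`. -/
def cpos {n : ℕ} (v : Fin n) : ℕ := if v.val = 0 then n else v.val

/-- Shift a vertex by `d` steps in the positive direction. -/
def shiftR {n : ℕ} (v : Fin n) (d : ℕ) : Fin n :=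
  ⟨(v.val + d) % n, Nat.mod_lt _ (Nat.lt_of_le_of_lt (Nat.zero_le _) v.isLt)⟩

/-- Shift a vertex by `d` steps in the negative direction. -/
def shiftL {n : ℕ} (v : Fin n) (d : ℕ) : Fin n := shiftR v (n - d % n)

/-- Distance (in `[1, n]`) from `v` to the nearest element of `H` in the positive direction. -/
def distR {n : ℕ} (H : Finset (Fin n)) (v : Fin n) : ℕ :=
  if h : ((Finset.Icc 1 n).filter fun d => shiftR v d ∈ H).Nonempty then
    ((Finset.Icc 1 n).filter fun d => shiftR v d ∈ H).min' h
  else 0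

/-- Distance (in `[1, n]`) from `v` to the nearest element of `H` in the negative direction. -/
def distL {n : ℕ} (H : Finset (Fin n)) (v : Fin n) : ℕ :=
  if h : ((Finset.Icc 1 n).filter fun d => shiftL v d ∈ H).Nonempty then
    ((Finset.Icc 1 n).filter fun d => shiftL v d ∈ H).min' h
  else 0

/-- Probability that the ball activated at `v` fills the nearest free hole in the positive
direction, when the current set of free holes is `H`, for the `p`-biased random walk. -/
noncomputable def rightProb {n : ℕ} (p : ℝ) (H : Finset (Fin n)) (v : Fin n) : ℝ :=
  if p = 1 / 2 then (distL H v : ℝ) / ((distL H v : ℝ) + (distR H v : ℝ))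
  else (1 - ((1 - p) / p) ^ distL H v) / (1 - ((1 - p) / p) ^ (distL H v + distR H v))

/-- New set of free holes after the ball at `v` makes its choice
(`true` = fill the nearest free hole in the positive direction). -/
def golfStep {n : ℕ} (H : Finset (Fin n)) (v : Fin n) (choice : Bool) : Finset (Fin n) :=
  if choice then H.erase (shiftR v (distR H v)) else H.erase (shiftL v (distL H v))

/-- Final set of free holes after activating the listed balls with the listed choices. -/
def golfRun {n : ℕ} : List (Fin n) → List Bool → Finset (Fin n) → Finset (Fin n)
  | v :: vs, c :: cs, H => golfRun vs cs (golfStep H v c)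
  | _, _, H => H

/-- Probability of a given sequence of left/right choices. -/
noncomputable def golfWeight {n : ℕ} (p : ℝ) :
    List (Fin n) → List Bool → Finset (Fin n) → ℝ
  | v :: vs, c :: cs, H =>
      (if c then rightProb p H v else 1 - rightProb p H v) * golfWeight p vs cs (golfStep H v c)
  | _, _, _ => 1

/-- Initial data of the golf model: an initial configuration with `nb` balls (listed in their
activation order, encoded as an embedding `Fin nb ↪ Fin n`) and `nt` holes, the balls and holes
being on distinct vertices.  The initial configuration together with the activation order is
uniform on this set. -/
noncomputable def golfInit (n nb nt : ℕ) : Finset ((Fin nb ↪ Fin n) × Finset (Fin n)) :=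
  Finset.univ.filter fun fT => fT.2.card = nt ∧ ∀ i, fT.1 i ∉ fT.2

/-- Expectation of `g B⁰ T⁰ TL` in the golf model on `Z/nZ` with `nb` balls, `nt` holes and
walk parameter `p`, where `B⁰` is the initial set of balls, `T⁰` the initial set of holes and
`TL` the final set of free holes. -/
noncomputable def golfExp (n nb nt : ℕ) (p : ℝ)
    (g : Finset (Fin n) → Finset (Fin n) → Finset (Fin n) → ℝ) : ℝ :=
  (∑ fT ∈ golfInit n nb nt, ∑ cs : Fin nb → Bool,
      golfWeight p (List.ofFn ⇑fT.1) (List.ofFn cs) fT.2 *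
        g (Finset.univ.map fT.1) fT.2 (golfRun (List.ofFn ⇑fT.1) (List.ofFn cs) fT.2)) /
    (golfInit n nb nt).card

/-- `golfProb n nb nt p X` is the probability that the final set of free holes is `X`. -/
noncomputable def golfProb (n nb nt : ℕ) (p : ℝ) (X : Finset (Fin n)) : ℝ :=
  golfExp n nb nt p fun _ _ TL => if TL = X then 1 else 0

/-- Sorted list of the canonical positions of the elements of `X`. -/
def sortedPos {n : ℕ} (X : Finset (Fin n)) : List ℕ := (X.image cpos).sort (· ≤ ·)

/-- `blockSize X i` is the size `Δ_i X` of the `i`-th block of `X`. -/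
def blockSize {n : ℕ} (X : Finset (Fin n)) (i : ℕ) : ℕ :=
  let q := sortedPos X
  let k := q.length
  (q.getD (i % k) 0 + n - q.getD ((i + k - 1) % k) 0 - 1) % n

/-- `blockSet X i` is the `i`-th block `B_i` of `X`: the set of vertices strictly between
`x_i` and `x_{i+1}` in the positive direction. -/
def blockSet {n : ℕ} (X : Finset (Fin n)) (i : ℕ) : Finset (Fin n) :=
  let q := sortedPos X
  let k := q.length
  let lo := q.getD ((i + k - 1) % k) 0
  let hi := q.getD (i % k) 0
  Finset.univ.filter fun v =>
    if lo < hi then lo < cpos v ∧ cpos v < hi else cpos v < hi ∨ lo < cpos v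

/-- Size of the largest block of `X`. -/
def maxBlockSize {n : ℕ} (X : Finset (Fin n)) : ℕ :=
  (Finset.range X.card).sup (blockSize X)

/-- `multinom3 a b c` is the multinomial coefficient `(a+b+c)! / (a! b! c!)`. -/
def multinom3 (a b c : ℕ) : ℕ :=
  (a + b + c).factorial / (a.factorial * b.factorial * c.factorial)

end Golf

namespace Golf

/-- A permutation of the cycle is a rotation when it commutes with the shifts. -/
def IsRotation {n : ℕ} (e : Fin n ≃ Fin n) : Prop :=
  ∀ v d, e (shiftR v d) = shiftR (e v) d

theorem exists_isRotation_apply_eq {n : ℕ} (x y : Fin n) :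
    ∃ e : Fin n ≃ Fin n, IsRotation e ∧ e x = y := by
  have : NeZero n := ⟨Nat.ne_of_gt (Nat.lt_of_le_of_lt (Nat.zero_le _) x.isLt)⟩
  refine ⟨Equiv.addRight (y - x), fun v d => ?_, by simp⟩
  ext
  simp only [Equiv.coe_addRight, shiftR, Fin.val_add, Nat.mod_add_mod]
  congr 1
  ring

section Rotation

variable {n : ℕ} {e : Fin n ≃ Fin n}

theorem IsRotation.shiftL (he : IsRotation e) (v : Fin n) (d : ℕ) :
    e (shiftL v d) = Golf.shiftL (e v) d := he _ _

theorem IsRotation.distR (he : IsRotation e) (H : Finset (Fin n)) (v : Fin n) :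
    distR (H.map e.toEmbedding) (e v) = Golf.distR H v := by
  have h : ∀ d, shiftR (e v) d ∈ H.map e.toEmbedding ↔ shiftR v d ∈ H := fun d => by
    rw [← he]; simp
  simp only [Golf.distR, h]

theorem IsRotation.distL (he : IsRotation e) (H : Finset (Fin n)) (v : Fin n) :
    distL (H.map e.toEmbedding) (e v) = Golf.distL H v := by
  have h : ∀ d, Golf.shiftL (e v) d ∈ H.map e.toEmbedding ↔ Golf.shiftL v d ∈ H := fun d => by
    rw [← he.shiftL]; simp
  simp only [Golf.distL, h]

theorem IsRotation.golfStep (he : IsRotation e) (H : Finset (Fin n)) (v : Fin n) (c : Bool) :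
    golfStep (H.map e.toEmbedding) (e v) c = (Golf.golfStep H v c).map e.toEmbedding := by
  have h : ∀ w, (H.map e.toEmbedding).erase (e w) = (H.erase w).map e.toEmbedding :=
    fun w => (Finset.map_erase e.toEmbedding H w).symm
  cases c
  · simp only [Golf.golfStep, he.distL, ← he.shiftL, h, Bool.false_eq_true, if_false]
  · simp only [Golf.golfStep, he.distR, ← he _ _, h, if_true]

theorem IsRotation.golfRun (he : IsRotation e) (l : List (Fin n)) (cs : List Bool)
    (H : Finset (Fin n)) :
    golfRun (l.map e) cs (H.map e.toEmbedding) = (Golf.golfRun l cs H).map e.toEmbedding := by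
  induction l generalizing cs H with
  | nil => simp [Golf.golfRun]
  | cons v l ih =>
    cases cs with
    | nil => simp [Golf.golfRun]
    | cons c cs => simp [Golf.golfRun, he.golfStep, ih]

theorem IsRotation.golfWeight (he : IsRotation e) (p : ℝ) (l : List (Fin n)) (cs : List Bool)
    (H : Finset (Fin n)) :
    golfWeight p (l.map e) cs (H.map e.toEmbedding) = Golf.golfWeight p l cs H := by
  induction l generalizing cs H with
  | nil => simp [Golf.golfWeight]
  | cons v l ih =>
    cases cs with
    | nil => simp [Golf.golfWeight]
    | cons c cs => simp [Golf.golfWeight, rightProb, he.golfStep, he.distR, he.distL, ih]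

/-- The golf model is invariant in law under rotations. -/
theorem IsRotation.golfExp (he : IsRotation e) (nb nt : ℕ) (p : ℝ)
    (g : Finset (Fin n) → Finset (Fin n) → Finset (Fin n) → ℝ) :
    (Golf.golfExp n nb nt p fun B T TL =>
      g (B.map e.toEmbedding) (T.map e.toEmbedding) (TL.map e.toEmbedding)) =
      Golf.golfExp n nb nt p g := by
  unfold Golf.golfExp
  congr 1
  refine Finset.sum_equiv
    (Equiv.prodCongr (Equiv.embeddingCongr (Equiv.refl _) e) (Equiv.finsetCongr e)) ?_ ?_
  · rintro ⟨f, T⟩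
    simp [golfInit]
  · rintro ⟨f, T⟩ -
    have hf : Equiv.embeddingCongr (Equiv.refl (Fin nb)) e f = f.trans e.toEmbedding := by
      ext; simp
    have hl : List.ofFn (f.trans e.toEmbedding) = (List.ofFn f).map e := by
      rw [List.map_ofFn]; rfl
    simp only [Equiv.prodCongr_apply, Prod.map, Equiv.finsetCongr_apply, hf, hl,
      he.golfRun, he.golfWeight, Finset.map_map]

end Rotation

theorem golfRun_subset {n : ℕ} (l : List (Fin n)) (cs : List Bool) (H : Finset (Fin n)) :
    golfRun l cs H ⊆ H := by
  induction l generalizing cs H with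
  | nil => simp [golfRun]
  | cons v l ih =>
    cases cs with
    | nil => simp [golfRun]
    | cons c cs =>
      refine (ih _ _).trans ?_
      unfold golfStep
      split <;> exact Finset.erase_subset _ _

theorem exists_shiftR_eq {n : ℕ} (v w : Fin n) : ∃ d ∈ Finset.Icc 1 n, shiftR v d = w := by
  have hv := v.isLt
  have hw := w.isLt
  by_cases h : v.val < w.val
  · refine ⟨w - v, Finset.mem_Icc.2 ⟨by omega, by omega⟩, Fin.ext ?_⟩
    simp only [shiftR]
    rw [show v.val + (w.val - v.val) = w by omega, Nat.mod_eq_of_lt hw]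
  · refine ⟨n + w - v, Finset.mem_Icc.2 ⟨by omega, by omega⟩, Fin.ext ?_⟩
    simp only [shiftR]
    rw [show v.val + (n + w.val - v.val) = n + w by omega, Nat.add_mod_left, Nat.mod_eq_of_lt hw]

theorem exists_shiftL_eq {n : ℕ} (v w : Fin n) : ∃ d ∈ Finset.Icc 1 n, shiftL v d = w := by
  obtain ⟨d, hd, rfl⟩ := exists_shiftR_eq v w
  rw [Finset.mem_Icc] at hd
  rcases hd.2.eq_or_lt with rfl | hlt
  · exact ⟨d, Finset.mem_Icc.2 hd, by simp [shiftL]⟩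
  · refine ⟨n - d, Finset.mem_Icc.2 ⟨by omega, by omega⟩, ?_⟩
    rw [shiftL, Nat.mod_eq_of_lt (by omega), show n - (n - d) = d by omega]

theorem shiftR_distR_mem {n : ℕ} {H : Finset (Fin n)} (hH : H.Nonempty) (v : Fin n) :
    shiftR v (distR H v) ∈ H := by
  obtain ⟨w, hw⟩ := hH
  obtain ⟨d, hd, rfl⟩ := exists_shiftR_eq v w
  have h : ((Finset.Icc 1 n).filter fun d => shiftR v d ∈ H).Nonempty :=
    ⟨d, Finset.mem_filter.2 ⟨hd, hw⟩⟩
  rw [distR, dif_pos h]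
  exact (Finset.mem_filter.1 (Finset.min'_mem _ h)).2

theorem shiftL_distL_mem {n : ℕ} {H : Finset (Fin n)} (hH : H.Nonempty) (v : Fin n) :
    shiftL v (distL H v) ∈ H := by
  obtain ⟨w, hw⟩ := hH
  obtain ⟨d, hd, rfl⟩ := exists_shiftL_eq v w
  have h : ((Finset.Icc 1 n).filter fun d => shiftL v d ∈ H).Nonempty :=
    ⟨d, Finset.mem_filter.2 ⟨hd, hw⟩⟩
  rw [distL, dif_pos h]
  exact (Finset.mem_filter.1 (Finset.min'_mem _ h)).2

theorem card_golfStep {n : ℕ} (H : Finset (Fin n)) (v : Fin n) (c : Bool) :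
    (golfStep H v c).card = H.card - 1 := by
  rcases H.eq_empty_or_nonempty with rfl | hH
  · simp [golfStep]
  · unfold golfStep
    split
    · exact Finset.card_erase_of_mem (shiftR_distR_mem hH v)
    · exact Finset.card_erase_of_mem (shiftL_distL_mem hH v)

theorem card_golfRun {n : ℕ} (l : List (Fin n)) (cs : List Bool) (H : Finset (Fin n))
    (h : l.length = cs.length) : (golfRun l cs H).card = H.card - l.length := by
  induction l generalizing cs H with
  | nil => simp [golfRun]
  | cons v l ih =>
    cases cs with
    | nil => simp at h
    | cons c cs =>
      rw [golfRun, ih _ _ (by simpa using h), card_golfStep, List.length_cons]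
      omega

theorem sum_golfWeight {n k : ℕ} (p : ℝ) (l : List (Fin n)) (h : l.length = k)
    (H : Finset (Fin n)) : ∑ cs : Fin k → Bool, golfWeight p l (List.ofFn cs) H = 1 := by
  induction l generalizing k H with
  | nil =>
    obtain rfl : k = 0 := h.symm
    simp [golfWeight]
  | cons v l ih =>
    obtain ⟨k, rfl⟩ : ∃ j, k = j + 1 := ⟨l.length, h.symm⟩
    rw [← (Fin.consEquiv fun _ => Bool).sum_comp, Fintype.sum_prod_type, Fintype.sum_bool]
    have hl : l.length = k := by simpa using h
    simp [Fin.consEquiv, List.ofFn_succ, golfWeight, ← Finset.mul_sum, ih hl]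

theorem golfInit_nonempty {n nb nt : ℕ} (h : nb + nt ≤ n) : (golfInit n nb nt).Nonempty := by
  let f : Fin nb ↪ Fin n := Fin.castLEEmb (by omega)
  have hcard : nt ≤ ((Finset.univ.map f)ᶜ).card := by
    rw [Finset.card_compl, Finset.card_map, Finset.card_univ, Fintype.card_fin, Fintype.card_fin]
    omega
  obtain ⟨T, hT, hTc⟩ := Finset.exists_subset_card_eq hcard
  refine ⟨(f, T), Finset.mem_filter.2 ⟨Finset.mem_univ _, hTc, fun i hi => ?_⟩⟩
  simpa using hT hi

theorem golfExp_congr {n nb nt : ℕ} (p : ℝ)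
    {g g' : Finset (Fin n) → Finset (Fin n) → Finset (Fin n) → ℝ}
    (h : ∀ B T TL, T.card = nt → TL ⊆ T → TL.card = nt - nb → g B T TL = g' B T TL) :
    golfExp n nb nt p g = golfExp n nb nt p g' := by
  unfold golfExp
  congr 1
  refine Finset.sum_congr rfl fun fT hfT => Finset.sum_congr rfl fun cs _ => ?_
  have hT := (Finset.mem_filter.1 hfT).2.1
  rw [h _ _ _ hT (golfRun_subset _ _ _) (by rw [card_golfRun _ _ _ (by simp), hT]; simp)]

theorem golfExp_const {n nb nt : ℕ} (h : nb + nt ≤ n) (p c : ℝ) :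
    (golfExp n nb nt p fun _ _ _ => c) = c := by
  have hne : ((golfInit n nb nt).card : ℝ) ≠ 0 :=
    Nat.cast_ne_zero.2 (golfInit_nonempty h).card_pos.ne'
  simp only [golfExp, ← Finset.sum_mul, sum_golfWeight p _ (List.length_ofFn), Finset.sum_const,
    nsmul_eq_mul, one_mul]
  field_simp

theorem golfExp_sum {n nb nt : ℕ} {ι : Type*} (s : Finset ι) (p : ℝ)
    (g : ι → Finset (Fin n) → Finset (Fin n) → Finset (Fin n) → ℝ) :
    (golfExp n nb nt p fun B T TL => ∑ i ∈ s, g i B T TL) =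
      ∑ i ∈ s, golfExp n nb nt p (g i) := by
  simp only [golfExp, Finset.mul_sum, ← Finset.sum_div]
  congr 1
  rw [Finset.sum_comm (s := s)]
  refine Finset.sum_congr rfl fun fT _ => ?_
  rw [Finset.sum_comm (s := s)]

/-- If a rotation-equivariant family of observables indexed by the vertices sums to `c`, then
each of its members has expectation `c / n`. -/
theorem golfExp_eq_div_of_sum_eq {n nb nt : ℕ} (h : nb + nt ≤ n) (p c : ℝ)
    (g : Fin n → Finset (Fin n) → Finset (Fin n) → Finset (Fin n) → ℝ)
    (hg : ∀ (e : Fin n ≃ Fin n) x B T TL,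
      g (e x) (B.map e.toEmbedding) (T.map e.toEmbedding) (TL.map e.toEmbedding) = g x B T TL)
    (hsum : ∀ B T TL, T.card = nt → TL.card = nt - nb → ∑ x, g x B T TL = c) (x : Fin n) :
    golfExp n nb nt p (g x) = c / n := by
  have hn : (n : ℝ) ≠ 0 :=
    Nat.cast_ne_zero.2 (Nat.lt_of_le_of_lt (Nat.zero_le _) x.isLt).ne'
  have hconst : ∀ y, golfExp n nb nt p (g y) = golfExp n nb nt p (g x) := fun y => by
    obtain ⟨e, he, rfl⟩ := exists_isRotation_apply_eq x y
    rw [← he.golfExp]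
    simp only [hg]
  have htotal : ∑ y, golfExp n nb nt p (g y) = c := by
    rw [← golfExp_sum, golfExp_congr p fun B T TL hT _ hTL => hsum B T TL hT hTL,
      golfExp_const h]
  simp only [hconst, Finset.sum_const, Finset.card_univ, Fintype.card_fin, nsmul_eq_mul] at htotal
  rw [← htotal]
  field_simp

end Golf

open Golf

/-- **The mini-golf case** (Lemma 2.1 of the paper): in the golf model on `Z/nZ` with
`nt = nb + 1` holes, for every vertex `x`, `P(TL = {x}) = 1/n` and
`P(TL = {x} | x ∈ T⁰) = 1/(nb+1)`. -/
theorem golf_minigolf_law (n nb : ℕ) (hn : 1 ≤ n) (hnbt : nb + (nb + 1) ≤ n)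
    (p : ℝ) (hp0 : 0 < p) (hp1 : p < 1) (x : Fin n) :
    golfProb n nb (nb + 1) p {x} = 1 / n ∧
    (golfExp n nb (nb + 1) p fun _ T TL => if TL = {x} ∧ x ∈ T then 1 else 0) /
        (golfExp n nb (nb + 1) p fun _ T _ => if x ∈ T then 1 else 0) =
      1 / (nb + 1) := by
  have hprob : golfProb n nb (nb + 1) p {x} = 1 / n := by
    refine golfExp_eq_div_of_sum_eq hnbt p 1 (fun x _ _ TL => if TL = {x} then 1 else 0)
      (fun e x _ _ TL => ?_) (fun _ _ TL _ hTL => ?_) x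
    · have h : TL.map e.toEmbedding = {e x} ↔ TL = {x} := by
        rw [← Finset.map_inj (f := e.toEmbedding) (s₂ := {x}), Finset.map_singleton]
        rfl
      simp only [h]
    · obtain ⟨y, rfl⟩ := Finset.card_eq_one.1 (by simpa using hTL)
      simp
  have hhole : (golfExp n nb (nb + 1) p fun _ T _ => if x ∈ T then 1 else 0) =
      ((nb : ℝ) + 1) / n := by
    refine golfExp_eq_div_of_sum_eq hnbt p _ (fun x _ T _ => if x ∈ T then 1 else 0)
      (fun e x _ T _ => ?_) (fun _ T _ hT _ => ?_) x
    · simp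
    · simp [hT]
  have hjoint : (golfExp n nb (nb + 1) p fun _ T TL => if TL = {x} ∧ x ∈ T then 1 else 0) =
      golfProb n nb (nb + 1) p {x} := by
    refine golfExp_congr p fun _ T TL _ hsub _ => ?_
    have h : TL = {x} ∧ x ∈ T ↔ TL = {x} :=
      and_iff_left_of_imp fun hx => hsub (hx ▸ Finset.mem_singleton_self x)
    simp only [h]
  have hn0 : (n : ℝ) ≠ 0 := Nat.cast_ne_zero.2 (by omega)
  have hnb0 : (nb : ℝ) + 1 ≠ 0 := by positivity
  refine ⟨hprob, ?_⟩
  rw [hjoint, hprob, hhole]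
  field_simp
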